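/- Let L be a nilpotent symplectic alternating algebra of dimension 2n ≥ 12 over any field with dim Z(L) = 2. Then dim L^2 = 2n − 2, dim L^3 = 2n − 3, and dim L^4 ∈ {2n − 4, 2n − 5}. -/

import Mathlib

/-- A symplectic alternating algebra structure on an `F`-vector space `L`:
a nondegenerate alternating bilinear form together with an alternating
bilinear product satisfying `(x·y, z) = (y·z, x)`. -/
structure SAAStruct (F : Type*) [Field F] (L : Type*) [AddCommGroup L] [Module F L] where
  form : L →ₗ[F] L →ₗ[F] F
  mul : L →ₗ[F] L →ₗ[F] L
  form_alt : ∀ x : L, form x x = 0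
  form_nondegen : ∀ x : L, (∀ y : L, form x y = 0) → x = 0
  mul_alt : ∀ x : L, mul x x = 0
  cyclic : ∀ x y z : L, form (mul x y) z = form (mul y z) x

namespace SAAStruct

variable {F : Type*} [Field F] {L : Type*} [AddCommGroup L] [Module F L]

/-- `I` is an ideal of the symplectic alternating algebra `A`. -/
def IsIdealSub (A : SAAStruct F L) (I : Submodule F L) : Prop :=
  ∀ x ∈ I, ∀ y : L, A.mul x y ∈ I

/-- An ascending chain of ideals `⊥ = I 0 ≤ I 1 ≤ ⋯ ≤ I k = ⊤`
with `I (s+1) · L ⊆ I s`. -/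
def CentralChain (A : SAAStruct F L) (I : ℕ → Submodule F L) (k : ℕ) : Prop :=
  I 0 = ⊥ ∧ I k = ⊤ ∧ (∀ s, s < k → I s ≤ I (s + 1)) ∧
  (∀ s, s ≤ k → A.IsIdealSub (I s)) ∧
  (∀ s, s < k → ∀ x ∈ I (s + 1), ∀ y : L, A.mul x y ∈ I s)

/-- `A` is nilpotent if it admits a central chain of ideals. -/
def IsNilpotent (A : SAAStruct F L) : Prop :=
  ∃ (k : ℕ) (I : ℕ → Submodule F L), A.CentralChain I k

/-- The nilpotency class of `A`: the least length of a central chain of ideals. -/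
noncomputable def nilClass (A : SAAStruct F L) : ℕ :=
  sInf {k | ∃ I : ℕ → Submodule F L, A.CentralChain I k}

/-- The center `Z(L) = {x : x·L = 0}`. -/
def center (A : SAAStruct F L) : Submodule F L := LinearMap.ker A.mul

/-- The lower central series, indexed so that `lcs A i` is `L^(i+1)`:
`lcs A 0 = L¹ = L` and `lcs A (i+1) = L^(i+2) = span {u·v : u ∈ L^(i+1), v ∈ L}`. -/
def lcs (A : SAAStruct F L) : ℕ → Submodule F L
  | 0 => ⊤
  | (i + 1) => Submodule.span F {z | ∃ u ∈ A.lcs i, ∃ v : L, z = A.mul u v}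

/-- The upper central series: `ucs A 0 = 0`, `ucs A (i+1) = {x : x·L ⊆ ucs A i}`. -/
def ucs (A : SAAStruct F L) : ℕ → Submodule F L
  | 0 => ⊥
  | (i + 1) =>
    { carrier := {x | ∀ y : L, A.mul x y ∈ A.ucs i}
      add_mem' := by
        intro a b ha hb y
        simpa [map_add, LinearMap.add_apply] using
          Submodule.add_mem _ (ha y) (hb y)
      zero_mem' := by
        intro y
        simp
      smul_mem' := by
        intro c a ha y
        simpa [map_smul, LinearMap.smul_apply] using
          Submodule.smul_mem _ c (ha y) }

/-- The perp `U^⊥ = {x : (x,u) = 0 for all u ∈ U}` of a subspace with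
respect to the alternating form of `A`. -/
def perp (A : SAAStruct F L) (U : Submodule F L) : Submodule F L :=
  { carrier := {x | ∀ u ∈ U, A.form x u = 0}
    add_mem' := by
      intro a b ha hb u hu
      simp [map_add, LinearMap.add_apply, ha u hu, hb u hu]
    zero_mem' := by
      intro u hu
      simp
    smul_mem' := by
      intro c a ha u hu
      simp [map_smul, LinearMap.smul_apply, ha u hu] }

/-- A subspace is isotropic if the form vanishes identically on it. -/
def Isotropic (A : SAAStruct F L) (U : Submodule F L) : Prop :=
  ∀ u ∈ U, ∀ v ∈ U, A.form u v = 0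

/-- A subspace is abelian if the product vanishes identically on it. -/
def AbelianSub (A : SAAStruct F L) (U : Submodule F L) : Prop :=
  ∀ u ∈ U, ∀ v ∈ U, A.mul u v = 0

end SAAStruct

/-- The function `Ω` with `Ω 0 = 0` and `Ω (m+1) = 2 + C(Ω m, 2)`. -/
def OmegaFn : ℕ → ℕ
  | 0 => 0
  | (m + 1) => 2 + Nat.choose (OmegaFn m) 2

/-- The entries of the Gram matrix of a standard (symplectic) basis
`x₁, y₁, x₂, y₂, …` enumerated as `b 0 = x₁, b 1 = y₁, b 2 = x₂, …`. -/
def stdJ (F : Type*) [Field F] {N : ℕ} (i j : Fin N) : F :=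
  if (i : ℕ) % 2 = 0 ∧ (j : ℕ) = (i : ℕ) + 1 then 1
  else if (j : ℕ) % 2 = 0 ∧ (i : ℕ) = (j : ℕ) + 1 then -1
  else 0

namespace SAAStruct

variable {F : Type*} [Field F] {L : Type*} [AddCommGroup L] [Module F L]

theorem mul_swap (A : SAAStruct F L) (x y : L) : A.mul x y = -A.mul y x := by
  have h := A.mul_alt (x + y)
  simp only [map_add, LinearMap.add_apply, A.mul_alt, zero_add, add_zero] at h
  exact eq_neg_of_add_eq_zero_right h

theorem mul_mem_lcs_succ (A : SAAStruct F L) {i : ℕ} {u : L} (hu : u ∈ A.lcs i) (v : L) :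
    A.mul u v ∈ A.lcs (i + 1) :=
  Submodule.subset_span ⟨u, hu, v, rfl⟩

theorem mul_mem_lcs_succ' (A : SAAStruct F L) {i : ℕ} {u : L} (hu : u ∈ A.lcs i) (v : L) :
    A.mul v u ∈ A.lcs (i + 1) := by
  rw [A.mul_swap]
  exact neg_mem (A.mul_mem_lcs_succ hu v)

theorem lcs_succ_le_iff (A : SAAStruct F L) {i : ℕ} {P : Submodule F L} :
    A.lcs (i + 1) ≤ P ↔ ∀ u ∈ A.lcs i, ∀ v, A.mul u v ∈ P := by
  refine ⟨fun h u hu v => h (A.mul_mem_lcs_succ hu v), fun h => Submodule.span_le.2 ?_⟩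
  rintro _ ⟨u, hu, v, rfl⟩
  exact h u hu v

theorem lcs_succ_le (A : SAAStruct F L) (i : ℕ) : A.lcs (i + 1) ≤ A.lcs i := by
  induction i with
  | zero => exact le_top
  | succ i ih => exact A.lcs_succ_le_iff.2 fun u hu v => A.mul_mem_lcs_succ (ih hu) v

theorem IsNilpotent.exists_lcs_eq_bot {A : SAAStruct F L} (h : A.IsNilpotent) :
    ∃ k, A.lcs k = ⊥ := by
  obtain ⟨k, I, h0, hk, -, -, hI⟩ := h
  have key : ∀ s, s ≤ k → A.lcs s ≤ I (k - s) := by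
    intro s
    induction s with
    | zero => intro _; simp [hk]
    | succ s ih =>
      intro hs
      refine A.lcs_succ_le_iff.2 fun u hu v => hI _ (by omega) u ?_ v
      have := ih (by omega) hu
      rwa [show k - s = k - (s + 1) + 1 by omega] at this
  exact ⟨k, by simpa [h0] using key k le_rfl⟩

theorem IsNilpotent.lcs_succ_lt {A : SAAStruct F L} (h : A.IsNilpotent) {i : ℕ}
    (hi : A.lcs i ≠ ⊥) : A.lcs (i + 1) < A.lcs i := by
  refine lt_of_le_of_ne (A.lcs_succ_le i) fun he => hi ?_
  obtain ⟨k, hk⟩ := h.exists_lcs_eq_bot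
  have stable : ∀ j, A.lcs i ≤ A.lcs j := by
    intro j
    induction j with
    | zero => exact le_top
    | succ j ih =>
      rw [← he]
      exact A.lcs_succ_le_iff.2 fun u hu v => A.mul_mem_lcs_succ (ih hu) v
  exact le_bot_iff.1 (hk ▸ stable k)

theorem mem_center_iff_form_lcs_one (A : SAAStruct F L) {x : L} :
    x ∈ A.center ↔ ∀ u ∈ A.lcs 1, A.form u x = 0 := by
  constructor
  · intro hx
    have hx : A.mul x = 0 := hx
    have : A.lcs 1 ≤ LinearMap.ker (A.form.flip x) :=
      A.lcs_succ_le_iff.2 fun u _ v => by simp [← A.cyclic x u v, hx]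
    exact fun u hu => this hu
  · intro h
    refine LinearMap.mem_ker.2 (LinearMap.ext fun y => A.form_nondegen _ fun z => ?_)
    rw [A.cyclic]
    exact h _ (A.mul_mem_lcs_succ (i := 0) trivial z)

theorem finrank_center_add_finrank_lcs_one [FiniteDimensional F L] (A : SAAStruct F L) :
    Module.finrank F A.center + Module.finrank F (A.lcs 1) = Module.finrank F L := by
  have hker : LinearMap.ker A.form = ⊥ := LinearMap.ker_eq_bot'.2 fun x hx =>
    A.form_nondegen x fun y => by rw [hx, LinearMap.zero_apply]
  have hnd : LinearMap.BilinForm.Nondegenerate A.form :=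
    (LinearMap.BilinForm.nondegenerate_iff_ker_eq_bot).2 hker
  have hc : A.center = LinearMap.BilinForm.orthogonal A.form (A.lcs 1) := by
    ext x
    exact A.mem_center_iff_form_lcs_one
  rw [hc, LinearMap.BilinForm.finrank_orthogonal hnd]
  exact Nat.sub_add_cancel (Submodule.finrank_le _)

/-- If `L` is spanned by `x`, `y` modulo `L²`, then `L²` is spanned by `x·y` modulo `L³`. -/
theorem lcs_one_le (A : SAAStruct F L) {x y : L}
    (h : ⊤ ≤ Submodule.span F {x, y} ⊔ A.lcs 1) :
    A.lcs 1 ≤ Submodule.span F {A.mul x y} ⊔ A.lcs 2 := by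
  refine A.lcs_succ_le_iff.2 fun u _ v => ?_
  obtain ⟨p, hp, s, hs, rfl⟩ := Submodule.mem_sup.1 (h (Submodule.mem_top (x := u)))
  obtain ⟨q, hq, t, ht, rfl⟩ := Submodule.mem_sup.1 (h (Submodule.mem_top (x := v)))
  obtain ⟨a, b, rfl⟩ := Submodule.mem_span_pair.1 hp
  obtain ⟨c, d, rfl⟩ := Submodule.mem_span_pair.1 hq
  refine Submodule.mem_sup.2 ⟨(a * d - b * c) • A.mul x y,
    Submodule.smul_mem _ _ (Submodule.mem_span_singleton_self _), _,
    add_mem (A.mul_mem_lcs_succ hs (c • x + d • y + t))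
      (A.mul_mem_lcs_succ' ht (a • x + b • y)), ?_⟩
  simp only [map_add, map_smul, LinearMap.add_apply, LinearMap.smul_apply, A.mul_alt,
    A.mul_swap y x]
  module

/-- If `L` is spanned by `x`, `y` modulo `L²` and `L²` is spanned by `w` modulo `L³`, then `L³` is
spanned by `w·x`, `w·y` modulo `L⁴`. -/
theorem lcs_two_le (A : SAAStruct F L) {x y w : L}
    (h : ⊤ ≤ Submodule.span F {x, y} ⊔ A.lcs 1)
    (hw : A.lcs 1 ≤ Submodule.span F {w} ⊔ A.lcs 2) :
    A.lcs 2 ≤ Submodule.span F {A.mul w x, A.mul w y} ⊔ A.lcs 3 := by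
  refine A.lcs_succ_le_iff.2 fun u hu v => ?_
  obtain ⟨p, hp, s, hs, rfl⟩ := Submodule.mem_sup.1 (hw hu)
  obtain ⟨a, rfl⟩ := Submodule.mem_span_singleton.1 hp
  obtain ⟨q, hq, t, ht, rfl⟩ := Submodule.mem_sup.1 (h (Submodule.mem_top (x := v)))
  obtain ⟨c, d, rfl⟩ := Submodule.mem_span_pair.1 hq
  obtain ⟨r, hr, k, hk, rfl⟩ := Submodule.mem_sup.1 (hw ht)
  obtain ⟨e, rfl⟩ := Submodule.mem_span_singleton.1 hr
  refine Submodule.mem_sup.2 ⟨(a * c) • A.mul w x + (a * d) • A.mul w y,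
    Submodule.mem_span_pair.2 ⟨_, _, rfl⟩, _,
    add_mem (A.mul_mem_lcs_succ hs (c • x + d • y + (e • w + k)))
      (A.mul_mem_lcs_succ' hk (a • w)), ?_⟩
  simp only [map_add, map_smul, LinearMap.add_apply, LinearMap.smul_apply, A.mul_alt]
  module

end SAAStruct

theorem Submodule.exists_top_le_span_pair_sup {F L : Type*} [Field F] [AddCommGroup L] [Module F L]
    [FiniteDimensional F L] (P : Submodule F L)
    (h : Module.finrank F P + 2 = Module.finrank F L) :
    ∃ x y : L, ⊤ ≤ Submodule.span F {x, y} ⊔ P := by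
  obtain ⟨C, hC⟩ := P.exists_isCompl
  have hfin : Module.finrank F C = 2 := by
    have := Submodule.finrank_add_eq_of_isCompl hC
    omega
  let b := Module.finBasisOfFinrankEq F C hfin
  refine ⟨b 0, b 1, ?_⟩
  rw [← hC.symm.sup_eq_top]
  refine sup_le_sup_right (fun z hz => Submodule.mem_span_pair.2 ?_) P
  refine ⟨b.repr ⟨z, hz⟩ 0, b.repr ⟨z, hz⟩ 1, ?_⟩
  have := congrArg Subtype.val (b.sum_repr ⟨z, hz⟩)
  rwa [Fin.sum_univ_two] at this

theorem Submodule.finrank_le_card_add_of_le_span_sup {F L : Type*} [Field F] [AddCommGroup L]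
    [Module F L] [FiniteDimensional F L] {s : Finset L} {P Q : Submodule F L}
    (h : Q ≤ Submodule.span F s ⊔ P) :
    Module.finrank F Q ≤ s.card + Module.finrank F P :=
  ((Submodule.finrank_mono h).trans (Submodule.finrank_add_le_finrank_add_finrank _ _)).trans
    (Nat.add_le_add_right (finrank_span_finset_le_card s) _)

/-- for a nilpotent SAA of dimension `2n ≥ 12` with `dim Z(L) = 2`:
`dim L² = 2n − 2`, `dim L³ = 2n − 3` and `dim L⁴ ∈ {2n − 4, 2n − 5}`.
(Here `A.lcs 1 = L²`, `A.lcs 2 = L³`, `A.lcs 3 = L⁴`.) -/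
theorem stmt15 (F : Type*) [Field F] (L : Type*) [AddCommGroup L] [Module F L]
    [FiniteDimensional F L] (A : SAAStruct F L) (n : ℕ)
    (hn : 6 ≤ n) (hdim : Module.finrank F L = 2 * n)
    (hnil : A.IsNilpotent) (hZ : Module.finrank F A.center = 2) :
    Module.finrank F (A.lcs 1) = 2 * n - 2 ∧
    Module.finrank F (A.lcs 2) = 2 * n - 3 ∧
    (Module.finrank F (A.lcs 3) = 2 * n - 4 ∨ Module.finrank F (A.lcs 3) = 2 * n - 5) := by
  classical
  have h1 : Module.finrank F (A.lcs 1) = 2 * n - 2 := by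
    have := A.finrank_center_add_finrank_lcs_one
    omega
  obtain ⟨x, y, hxy⟩ := (A.lcs 1).exists_top_le_span_pair_sup (by omega)
  have hw := A.lcs_one_le hxy
  have hwxy := A.lcs_two_le hxy hw
  have drop : ∀ i, 0 < Module.finrank F (A.lcs i) →
      Module.finrank F (A.lcs (i + 1)) < Module.finrank F (A.lcs i) := fun i hi =>
    Submodule.finrank_lt_finrank_of_lt
      (hnil.lcs_succ_lt fun h => by rw [h, finrank_bot] at hi; exact hi.false)
  have h2 : Module.finrank F (A.lcs 1) ≤ 1 + Module.finrank F (A.lcs 2) :=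
    Submodule.finrank_le_card_add_of_le_span_sup (s := {A.mul x y}) (by simpa using hw)
  have h3 : Module.finrank F (A.lcs 2) ≤ 2 + Module.finrank F (A.lcs 3) :=
    (Submodule.finrank_le_card_add_of_le_span_sup
      (s := {A.mul (A.mul x y) x, A.mul (A.mul x y) y}) (by simpa using hwxy)).trans
      (Nat.add_le_add_right Finset.card_le_two _)
  have d1 : Module.finrank F (A.lcs 2) < Module.finrank F (A.lcs 1) := drop 1 (by omega)
  have d2 : Module.finrank F (A.lcs 3) < Module.finrank F (A.lcs 2) := drop 2 (by omega)
  omega
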